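/- Let M be a closed parallel-move based digital surface in ℤ³. Then every point p ∈ M has exactly 3, 4, 5, or 6 directly adjacent (6-adjacent) points belonging to M. -/

import Mathlib

open scoped BigOperators

/-- Points of the 3D grid space ℤ³. -/
abbrev Pt : Type := Fin 3 → ℤ

/-- The unit vector in direction `i`. -/
def unitVec (i : Fin 3) : Pt := fun j => if j = i then 1 else 0

/-- Direct (6-)adjacency: Euclidean distance one. -/
def Adj6 (p q : Pt) : Prop := ∑ i, (p i - q i) ^ 2 = 1

/-- A 1-cell: a pair of directly adjacent grid points (a unit segment). -/
def Is1Cell (e : Finset Pt) : Prop := ∃ p q : Pt, Adj6 p q ∧ e = {p, q}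

/-- A 2-cell: a unit lattice square of 4 grid points. -/
def Is2Cell (c : Finset Pt) : Prop :=
  ∃ (p : Pt) (i j : Fin 3), i ≠ j ∧
    c = {p, p + unitVec i, p + unitVec j, p + unitVec i + unitVec j}

/-- A 3-cell: a unit lattice cube of 8 grid points. -/
def Is3Cell (c : Finset Pt) : Prop :=
  ∃ p : Pt,
    c = {p, p + unitVec 0, p + unitVec 1, p + unitVec 0 + unitVec 1,
         p + unitVec 2, p + unitVec 0 + unitVec 2, p + unitVec 1 + unitVec 2,
         p + unitVec 0 + unitVec 1 + unitVec 2}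

/-- `e'` is a parallel-move of the 1-cell `e` within `S`: `e'` is a 1-cell of `S`
obtained by a unit translation of `e` so that `e ∪ e'` is a 2-cell contained in `S`. -/
def ParallelMove (S : Set Pt) (e e' : Finset Pt) : Prop :=
  Is1Cell e' ∧ Is2Cell (e ∪ e') ∧ (↑(e ∪ e') : Set Pt) ⊆ S

/-- 6-connectedness of a set of grid points. -/
def Conn6 (S : Set Pt) : Prop :=
  ∀ p ∈ S, ∀ q ∈ S, Relation.ReflTransGen (fun a b => a ∈ S ∧ b ∈ S ∧ Adj6 a b) p q

/-- `c` is a 2-cell contained in `S`. -/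
def TwoCellIn (S : Set Pt) (c : Finset Pt) : Prop := Is2Cell c ∧ (↑c : Set Pt) ⊆ S

/-- Two 2-cells of `S` are 1-connected in `S` if joined by a chain of 2-cells of `S`
in which consecutive ones share a 1-cell. -/
def OneConnectedIn (S : Set Pt) (c c' : Finset Pt) : Prop :=
  Relation.ReflTransGen
    (fun a b => TwoCellIn S a ∧ TwoCellIn S b ∧ ∃ e, Is1Cell e ∧ e ⊆ a ∧ e ⊆ b) c c'

/-- Parallel-move based digital surface (Chen–Zhang). -/
def IsDigitalSurface (S : Set Pt) : Prop :=
  Conn6 S ∧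
  (∀ p ∈ S, ∃ c, Is2Cell c ∧ p ∈ c ∧ (↑c : Set Pt) ⊆ S) ∧
  (∀ c c', TwoCellIn S c → TwoCellIn S c' → OneConnectedIn S c c') ∧
  (∀ e, Is1Cell e → (↑e : Set Pt) ⊆ S →
    {e' | ParallelMove S e e'}.ncard = 1 ∨ {e' | ParallelMove S e e'}.ncard = 2) ∧
  (∀ c, Is3Cell c → ¬ (↑c : Set Pt) ⊆ S)

/-- A closed digital surface: every 1-cell of `S` has exactly two parallel-moves. -/
def IsClosedDigitalSurface (S : Set Pt) : Prop :=
  IsDigitalSurface S ∧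
  ∀ e, Is1Cell e → (↑e : Set Pt) ⊆ S → {e' | ParallelMove S e e'}.ncard = 2

/-- The number of directly (6-)adjacent points of `p` belonging to `S`. -/
noncomputable def deg6 (S : Set Pt) (p : Pt) : ℕ := {q ∈ S | Adj6 p q}.ncard

theorem adj6_add_unitVec (p : Pt) (i : Fin 3) : Adj6 p (p + unitVec i) := by
  simp [Adj6, unitVec]

theorem Adj6.symm {p q : Pt} (h : Adj6 p q) : Adj6 q p := by
  unfold Adj6 at *
  rw [← h]
  exact Finset.sum_congr rfl fun i _ => by ring

theorem not_adj6_self (p : Pt) : ¬ Adj6 p p := by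
  simp [Adj6]

theorem unitVec_injective : Function.Injective unitVec := by
  intro i j h
  simpa [unitVec] using congrFun h i

theorem not_adj6_add_add {i j : Fin 3} (hij : i ≠ j) (p : Pt) :
    ¬ Adj6 p (p + unitVec i + unitVec j) := by
  fin_cases i <;> fin_cases j <;> simp [Adj6, Fin.sum_univ_three, unitVec] at hij ⊢

theorem not_adj6_add_unitVec_add_unitVec {i j : Fin 3} (hij : i ≠ j) (p : Pt) :
    ¬ Adj6 (p + unitVec i) (p + unitVec j) := by
  fin_cases i <;> fin_cases j <;> simp [Adj6, Fin.sum_univ_three, unitVec] at hij ⊢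

/-- The six points directly adjacent to `p`. -/
def adjFinset (p : Pt) : Finset Pt :=
  Finset.univ.image (fun i => p + unitVec i) ∪ Finset.univ.image (fun i => p - unitVec i)

theorem card_adjFinset_le (p : Pt) : (adjFinset p).card ≤ 6 := by
  refine (Finset.card_union_le _ _).trans ?_
  have h₁ := Finset.card_image_le (s := Finset.univ) (f := fun i => p + unitVec i)
  have h₂ := Finset.card_image_le (s := Finset.univ) (f := fun i => p - unitVec i)
  rw [Finset.card_univ, Fintype.card_fin] at h₁ h₂
  omega

theorem Adj6.mem_adjFinset {p q : Pt} (h : Adj6 p q) : q ∈ adjFinset p := by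
  obtain ⟨d, rfl⟩ : ∃ d, q = p + d := ⟨q - p, by abel⟩
  have hd : d 0 ^ 2 + d 1 ^ 2 + d 2 ^ 2 = 1 := by
    simpa [Adj6, Fin.sum_univ_three] using h
  have bound (a : ℤ) (ha : a ^ 2 ≤ 1) : a = -1 ∨ a = 0 ∨ a = 1 := by
    have : -1 ≤ a := by nlinarith
    have : a ≤ 1 := by nlinarith
    omega
  have key : ∃ i, d = unitVec i ∨ d = -unitVec i := by
    simp only [funext_iff, Fin.forall_fin_succ, Fin.exists_fin_succ, unitVec, Pi.neg_apply]
    rcases bound (d 0) (by nlinarith [sq_nonneg (d 1), sq_nonneg (d 2)]) with h0 | h0 | h0 <;>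
    rcases bound (d 1) (by nlinarith [sq_nonneg (d 0), sq_nonneg (d 2)]) with h1 | h1 | h1 <;>
    rcases bound (d 2) (by nlinarith [sq_nonneg (d 0), sq_nonneg (d 1)]) with h2 | h2 | h2 <;>
    simp [h0, h1, h2] at hd ⊢
  obtain ⟨i, rfl | rfl⟩ := key
  · simp [adjFinset]
  · simp [adjFinset, sub_eq_add_neg]

theorem finite_adj6 (S : Set Pt) (p : Pt) : {q ∈ S | Adj6 p q}.Finite :=
  (adjFinset p).finite_toSet.subset fun _ hq => hq.2.mem_adjFinset

theorem deg6_le_six (S : Set Pt) (p : Pt) : deg6 S p ≤ 6 := by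
  refine le_trans ?_ (card_adjFinset_le p)
  rw [← Set.ncard_coe_finset]
  exact Set.ncard_le_ncard (fun _ hq => hq.2.mem_adjFinset) (adjFinset p).finite_toSet

theorem Is1Cell.card_le_two {e : Finset Pt} (he : Is1Cell e) : e.card ≤ 2 := by
  obtain ⟨p, q, -, rfl⟩ := he
  exact Finset.card_le_two

theorem Is2Cell.exists_adj6_mem {c : Finset Pt} (hc : Is2Cell c) {p : Pt} (hp : p ∈ c) :
    ∃ q ∈ c, Adj6 p q := by
  obtain ⟨x, i, j, -, rfl⟩ := hc
  simp only [Finset.mem_insert, Finset.mem_singleton] at hp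
  rcases hp with rfl | rfl | rfl | rfl
  · exact ⟨p + unitVec i, by simp, adj6_add_unitVec _ _⟩
  · exact ⟨x, by simp, (adj6_add_unitVec _ _).symm⟩
  · exact ⟨x, by simp, (adj6_add_unitVec _ _).symm⟩
  · exact ⟨x + unitVec i, by simp, (adj6_add_unitVec _ _).symm⟩

/-- Opposite to a side `{p, q}` of a 2-cell lies the side `{r, r + q - p}`, where `r` is the other
neighbour of `p` in the 2-cell. -/
theorem Is2Cell.exists_opposite {c : Finset Pt} (hc : Is2Cell c) {p q : Pt} (hp : p ∈ c)
    (hq : q ∈ c) (hpq : Adj6 p q) :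
    ∃ r, Adj6 p r ∧ r ≠ q ∧ r + q ≠ p + p ∧ r ∈ c ∧ r + q - p ∈ c := by
  obtain ⟨x, i, j, hij, rfl⟩ := hc
  have hne : unitVec i ≠ unitVec j := unitVec_injective.ne hij
  have hsum : unitVec i + unitVec j ≠ 0 := fun h => by
    simpa [unitVec, hij] using congrFun h i
  have hj : Adj6 (x + unitVec j) (x + unitVec i + unitVec j) :=
    add_right_comm x (unitVec i) (unitVec j) ▸ adj6_add_unitVec _ i
  have hdiag := not_adj6_add_add hij x
  have hdiag' := not_adj6_add_unitVec_add_unitVec hij x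
  simp only [Finset.mem_insert, Finset.mem_singleton] at hp hq ⊢
  rcases hp with hp | hp | hp | hp <;> rcases hq with hq | hq | hq | hq <;> subst p q
  · exact absurd hpq (not_adj6_self _)
  · exact ⟨x + unitVec j, adj6_add_unitVec _ _, fun h => hne (by linear_combination -h),
      fun h => hsum (by linear_combination h), by simp, .inr (.inr (.inr (by abel)))⟩
  · exact ⟨x + unitVec i, adj6_add_unitVec _ _, fun h => hne (by linear_combination h),
      fun h => hsum (by linear_combination h), by simp, .inr (.inr (.inr (by abel)))⟩
  · exact absurd hpq hdiag
  · exact ⟨x + unitVec i + unitVec j, adj6_add_unitVec _ _,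
      fun h => hsum (by linear_combination h),
      fun h => hne (by linear_combination -h), by simp, .inr (.inr (.inl (by abel)))⟩
  · exact absurd hpq (not_adj6_self _)
  · exact absurd hpq hdiag'
  · exact ⟨x, (adj6_add_unitVec _ _).symm, fun h => hsum (by linear_combination -h),
      fun h => hne (by linear_combination -h), by simp, .inr (.inr (.inl (by abel)))⟩
  · exact ⟨x + unitVec i + unitVec j, hj, fun h => hsum (by linear_combination h),
      fun h => hne (by linear_combination h), by simp, .inr (.inl (by abel))⟩
  · exact absurd hpq.symm hdiag'
  · exact absurd hpq (not_adj6_self _)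
  · exact ⟨x, (adj6_add_unitVec _ _).symm, fun h => hsum (by linear_combination -h),
      fun h => hne (by linear_combination h), by simp, .inr (.inl (by abel))⟩
  · exact absurd hpq.symm hdiag
  · exact ⟨x + unitVec j, hj.symm, fun h => hne (by linear_combination -h),
      fun h => hsum (by linear_combination -h), by simp, .inl (by abel)⟩
  · exact ⟨x + unitVec i, (adj6_add_unitVec _ _).symm, fun h => hne (by linear_combination h),
      fun h => hsum (by linear_combination -h), by simp, .inl (by abel)⟩
  · exact absurd hpq (not_adj6_self _)

theorem ParallelMove.exists_eq {S : Set Pt} {p q : Pt} {e : Finset Pt}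
    (h : ParallelMove S {p, q} e) (hpq : Adj6 p q) :
    ∃ r ∈ S, Adj6 p r ∧ r ≠ q ∧ e = {r, r + q - p} := by
  obtain ⟨he, hc, hS⟩ := h
  obtain ⟨r, hpr, hrq, hopp, hr, hr'⟩ :=
    hc.exists_opposite (p := p) (q := q) (by simp) (by simp) hpq
  refine ⟨r, hS hr, hpr, hrq, ?_⟩
  have hrp : r ≠ p := fun h => not_adj6_self p (h ▸ hpr)
  have hqp : q ≠ p := fun h => not_adj6_self p (h ▸ hpq)
  have hp' : r + q - p ≠ p := fun h => hopp (sub_eq_iff_eq_add.mp h)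
  have hq' : r + q - p ≠ q := fun h => hrp (by linear_combination h)
  have hrr : r ≠ r + q - p := fun h => hqp (by linear_combination -h)
  have hre : r ∈ e := by simpa [hrp, hrq] using hr
  have hre' : r + q - p ∈ e := by simpa [hp', hq'] using hr'
  refine (Finset.eq_of_subset_of_card_le ?_ ?_).symm
  · simp [Finset.insert_subset_iff, hre, hre']
  · rw [Finset.card_pair hrr]
    exact he.card_le_two

theorem three_le_deg6 {S : Set Pt} {p q : Pt} (hpq : Adj6 p q) (hqS : q ∈ S)
    (h : {e | ParallelMove S {p, q} e}.ncard = 2) : 3 ≤ deg6 S p := by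
  obtain ⟨e₁, e₂, hne, he⟩ := Set.ncard_eq_two.mp h
  have h₁ : ParallelMove S {p, q} e₁ := he.ge (Set.mem_insert _ _)
  have h₂ : ParallelMove S {p, q} e₂ := he.ge (Set.mem_insert_of_mem _ rfl)
  obtain ⟨r₁, hS₁, hadj₁, hq₁, rfl⟩ := h₁.exists_eq hpq
  obtain ⟨r₂, hS₂, hadj₂, hq₂, rfl⟩ := h₂.exists_eq hpq
  have hr : r₁ ≠ r₂ := by
    rintro rfl
    exact hne rfl
  refine (Set.two_lt_ncard (finite_adj6 S p)).mpr ?_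
  exact ⟨q, ⟨hqS, hpq⟩, r₁, ⟨hS₁, hadj₁⟩, r₂, ⟨hS₂, hadj₂⟩, hq₁.symm, hq₂.symm, hr⟩

/-- **Classification of points on closed digital surfaces (Chen–Zhang).**
Every point of a closed parallel-move based digital surface in ℤ³ has exactly
3, 4, 5, or 6 directly (6-)adjacent points in the surface. -/
theorem surface_point_classification (M : Set Pt) (hM : IsClosedDigitalSurface M) :
    ∀ p ∈ M, deg6 M p = 3 ∨ deg6 M p = 4 ∨ deg6 M p = 5 ∨ deg6 M p = 6 := by
  obtain ⟨⟨-, hcover, -, -, -⟩, hclosed⟩ := hM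
  intro p hp
  suffices h : 3 ≤ deg6 M p by
    have := deg6_le_six M p
    omega
  obtain ⟨c, hc, hpc, hcM⟩ := hcover p hp
  obtain ⟨q, hqc, hpq⟩ := hc.exists_adj6_mem hpc
  exact three_le_deg6 hpq (hcM hqc) (hclosed _ ⟨p, q, hpq, rfl⟩ (by
    intro x hx
    simp only [Finset.coe_insert, Finset.coe_singleton, Set.mem_insert_iff,
      Set.mem_singleton_iff] at hx
    rcases hx with rfl | rfl
    exacts [hp, hcM hqc]))
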